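/- arXiv:2509.00929 — 2 statements merged into one kernel-verified Lean document; each statement's English description precedes it below -/
import Mathlib

section
/- Suppose for some i ∈ {1,...,5} (indices modulo 5) both B_i and B_{i+2} are nonempty. If A_i ∪ A_{i+2} ≠ ∅, or both A_{i−2} ≠ ∅ and A_{i−1} ≠ ∅, then |B_i| = |B_{i+2}| = 1. -/
open SimpleGraph

/-- The disjoint union `P2 ∪ P3`: an edge 0-1 together with a path 2-3-4. -/
def p2p3 : SimpleGraph (Fin 5) :=
  SimpleGraph.fromEdgeSet {s(0,1), s(2,3), s(3,4)}

variable {V : Type*}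

/-- `S0` is the vertex set of the induced 5-cycle. -/
def S0 (v : Fin 5 → V) : Set V := Set.range v

/-- `Aset H v i` is the set of vertices outside `S0` whose neighborhood in `S0`
is exactly `{v i}`. -/
def Aset (H : SimpleGraph V) (v : Fin 5 → V) (i : Fin 5) : Set V :=
  {x | x ∉ S0 v ∧ ∀ j : Fin 5, H.Adj x (v j) ↔ j = i}

/-- `Bset H v i` is the set of vertices outside `S0` whose neighborhood in `S0`
is exactly `{v (i-1), v (i+1)}`. -/
def Bset (H : SimpleGraph V) (v : Fin 5 → V) (i : Fin 5) : Set V :=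
  {x | x ∉ S0 v ∧ ∀ j : Fin 5, H.Adj x (v j) ↔ (j = i - 1 ∨ j = i + 1)}

/-- `S2set H v` is the set of vertices at distance exactly 2 from `S0`: vertices outside `S0`
with no neighbor in `S0` but with a neighbor having a neighbor in `S0`. -/
def S2set (H : SimpleGraph V) (v : Fin 5 → V) : Set V :=
  {x | x ∉ S0 v ∧ (∀ j : Fin 5, ¬ H.Adj x (v j)) ∧
    ∃ y, H.Adj x y ∧ ∃ j : Fin 5, H.Adj y (v j)}

/-- `S` is complete to `T`: every vertex of `S` is adjacent to every vertex of `T`. -/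
def Complete (H : SimpleGraph V) (S T : Set V) : Prop := ∀ x ∈ S, ∀ y ∈ T, H.Adj x y

/-- `S` is anticomplete to `T`: there are no edges between `S` and `T`. -/
def Anticomplete (H : SimpleGraph V) (S T : Set V) : Prop := ∀ x ∈ S, ∀ y ∈ T, ¬ H.Adj x y

/-- `hA` is the number of indices `i` with `A_i` nonempty. -/
noncomputable def hA (H : SimpleGraph V) (v : Fin 5 → V) : ℕ :=
  {i : Fin 5 | (Aset H v i).Nonempty}.ncard

/-- `hB` is the number of indices `i` with `B_i` nonempty. -/
noncomputable def hB (H : SimpleGraph V) (v : Fin 5 → V) : ℕ :=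
  {i : Fin 5 | (Bset H v i).Nonempty}.ncard

theorem not_adj_of_common_neighbor {H : SimpleGraph V} (htriangle : H.CliqueFree 3) {x y z : V}
    (hx : H.Adj x z) (hy : H.Adj y z) : ¬ H.Adj x y := by
  classical
  exact fun h => htriangle _ (is3Clique_triple_iff.2 ⟨h, hx, hy⟩)

/-- An edge `a b` and a path `x y z` with no edges between them do not coexist in a
triangle-free graph without induced `P2 ∪ P3`. -/
theorem false_of_edge_of_path {H : SimpleGraph V} (htriangle : H.CliqueFree 3)
    (hP2P3 : ¬ Nonempty (p2p3 ↪g H)) {a b x y z : V} (hab : H.Adj a b) (hxy : H.Adj x y)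
    (hyz : H.Adj y z) (hxz : x ≠ z) (hax : ¬ H.Adj a x) (hay : ¬ H.Adj a y) (haz : ¬ H.Adj a z)
    (hbx : ¬ H.Adj b x) (hby : ¬ H.Adj b y) (hbz : ¬ H.Adj b z) : False := by
  have hnxz : ¬ H.Adj x z := not_adj_of_common_neighbor htriangle hxy hyz.symm
  have hadj : ∀ j k : Fin 5,
      H.Adj (![a, b, x, y, z] j) (![a, b, x, y, z] k) ↔ p2p3.Adj j k := by
    intro j k
    fin_cases j <;> fin_cases k <;> simp [p2p3, H.adj_comm, *]
  refine hP2P3 ⟨⟨⟨![a, b, x, y, z], fun j k hjk => ?_⟩, hadj _ _⟩⟩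
  fin_cases j <;> fin_cases k <;> simp at hjk ⊢ <;> subst hjk <;>
    simp_all [H.adj_comm]

theorem adj_of_mem_Aset_zero_of_mem_Bset_two {H : SimpleGraph V} {v : Fin 5 → V}
    (hC5 : ∀ i j : Fin 5, H.Adj (v i) (v j) ↔ (j = i + 1 ∨ i = j + 1))
    (htriangle : H.CliqueFree 3) (hP2P3 : ¬ Nonempty (p2p3 ↪g H)) {a c : V}
    (ha : a ∈ Aset H v 0) (hc : c ∈ Bset H v 2) : H.Adj a c := by
  by_contra hac
  refine false_of_edge_of_path htriangle hP2P3 (a := a) (b := v 0) (x := v 2) (y := v 3) (z := c)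
    ?_ ?_ ?_ (fun h => hc.1 ⟨2, h⟩) ?_ ?_ hac ?_ ?_ ?_ <;>
    simp [H.adj_comm _ c, ha.2, hc.2, hC5]

theorem subsingleton_of_nonempty_Aset_zero {H : SimpleGraph V} {v : Fin 5 → V}
    (hC5 : ∀ i j : Fin 5, H.Adj (v i) (v j) ↔ (j = i + 1 ∨ i = j + 1))
    (htriangle : H.CliqueFree 3) (hP2P3 : ¬ Nonempty (p2p3 ↪g H))
    (hB0 : (Bset H v 0).Nonempty) (hB2 : (Bset H v 2).Nonempty) (hA : (Aset H v 0).Nonempty) :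
    (Bset H v 0).Subsingleton ∧ (Bset H v 2).Subsingleton := by
  obtain ⟨a, ha⟩ := hA
  have hac : ∀ c ∈ Bset H v 2, H.Adj a c := fun c hc =>
    adj_of_mem_Aset_zero_of_mem_Bset_two hC5 htriangle hP2P3 ha hc
  have hab : ∀ b ∈ Bset H v 0, ¬ H.Adj a b := fun b hb hab => by
    refine false_of_edge_of_path htriangle hP2P3 (a := v 2) (b := v 3) (x := v 0) (y := a) (z := b)
      ?_ ?_ hab (fun h => hb.1 ⟨0, h⟩) ?_ ?_ ?_ ?_ ?_ ?_ <;>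
      simp [H.adj_comm _ a, H.adj_comm _ b, ha.2, hb.2, hC5,
        show (-1 : Fin 5) = 4 from rfl]
  have hcb : ∀ c ∈ Bset H v 2, ∀ b ∈ Bset H v 0, ¬ H.Adj c b := fun c hc b hb =>
    not_adj_of_common_neighbor htriangle (z := v 1) (by simp [hc.2]) (by simp [hb.2])
  constructor
  · intro b hb b' hb'
    by_contra hne
    obtain ⟨c, hc⟩ := hB2
    refine false_of_edge_of_path htriangle hP2P3 (y := v 4) (hac c hc) ?_ ?_ hne
      (hab b hb) ?_ (hab b' hb') (hcb c hc b hb) ?_ (hcb c hc b' hb') <;>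
      simp [H.adj_comm _ b', ha.2, hb.2, hb'.2, hc.2,
        show (-1 : Fin 5) = 4 from rfl]
  · intro c hc c' hc'
    by_contra hne
    obtain ⟨b, hb⟩ := hB0
    refine false_of_edge_of_path htriangle hP2P3 (a := b) (b := v 4) ?_ (hac c hc).symm
      (hac c' hc') hne (fun h => hcb c hc b hb h.symm) (fun h => hab b hb h.symm)
      (fun h => hcb c' hc' b hb h.symm) ?_ ?_ ?_ <;>
      simp [H.adj_comm (v _), ha.2, hb.2, hc.2, hc'.2,
        show (-1 : Fin 5) = 4 from rfl]

theorem Aset_comp {H : SimpleGraph V} {v : Fin 5 → V} (σ : Equiv.Perm (Fin 5)) (i : Fin 5) :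
    Aset H (v ∘ σ) i = Aset H v (σ i) := by
  ext x
  simp [Aset, S0, ← σ.forall_congr_right (q := fun j => H.Adj x (v j) ↔ j = σ i),
    σ.surjective.range_comp]

theorem Bset_comp {H : SimpleGraph V} {v : Fin 5 → V} (σ : Equiv.Perm (Fin 5)) (i : Fin 5)
    (hσ : ∀ j, (σ j = σ i - 1 ∨ σ j = σ i + 1) ↔ (j = i - 1 ∨ j = i + 1)) :
    Bset H (v ∘ σ) i = Bset H v (σ i) := by
  ext x
  simp [Bset, S0, ← σ.forall_congr_right
    (q := fun j => H.Adj x (v j) ↔ (j = σ i - 1 ∨ j = σ i + 1)), σ.surjective.range_comp, hσ]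

theorem Aset_addLeft {H : SimpleGraph V} {v : Fin 5 → V} (i j : Fin 5) :
    Aset H (v ∘ Equiv.addLeft i) j = Aset H v (i + j) :=
  Aset_comp (Equiv.addLeft i) j

theorem Aset_subLeft {H : SimpleGraph V} {v : Fin 5 → V} (i j : Fin 5) :
    Aset H (v ∘ Equiv.subLeft i) j = Aset H v (i - j) :=
  Aset_comp (Equiv.subLeft i) j

theorem Bset_addLeft {H : SimpleGraph V} {v : Fin 5 → V} (i j : Fin 5) :
    Bset H (v ∘ Equiv.addLeft i) j = Bset H v (i + j) :=
  Bset_comp (Equiv.addLeft i) j (by revert i j; decide)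

theorem Bset_subLeft {H : SimpleGraph V} {v : Fin 5 → V} (i j : Fin 5) :
    Bset H (v ∘ Equiv.subLeft i) j = Bset H v (i - j) :=
  Bset_comp (Equiv.subLeft i) j (by revert i j; decide)

theorem adj_comp_addLeft_iff {H : SimpleGraph V} {v : Fin 5 → V}
    (hC5 : ∀ i j : Fin 5, H.Adj (v i) (v j) ↔ (j = i + 1 ∨ i = j + 1)) (k i j : Fin 5) :
    H.Adj ((v ∘ Equiv.addLeft k) i) ((v ∘ Equiv.addLeft k) j) ↔ (j = i + 1 ∨ i = j + 1) :=
  (hC5 _ _).trans (by revert k i j; decide)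

theorem adj_comp_subLeft_iff {H : SimpleGraph V} {v : Fin 5 → V}
    (hC5 : ∀ i j : Fin 5, H.Adj (v i) (v j) ↔ (j = i + 1 ∨ i = j + 1)) (k i j : Fin 5) :
    H.Adj ((v ∘ Equiv.subLeft k) i) ((v ∘ Equiv.subLeft k) j) ↔ (j = i + 1 ∨ i = j + 1) :=
  (hC5 _ _).trans (by revert k i j; decide)

theorem Bset_zero_subsingleton {H : SimpleGraph V} {v : Fin 5 → V}
    (hC5 : ∀ i j : Fin 5, H.Adj (v i) (v j) ↔ (j = i + 1 ∨ i = j + 1))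
    (htriangle : H.CliqueFree 3) (hP2P3 : ¬ Nonempty (p2p3 ↪g H))
    (hB2 : (Bset H v 2).Nonempty) (hA3 : (Aset H v 3).Nonempty) (hA4 : (Aset H v 4).Nonempty) :
    (Bset H v 0).Subsingleton := by
  obtain ⟨a, ha⟩ := hA3
  obtain ⟨d, hd⟩ := hA4
  obtain ⟨c, hc⟩ := hB2
  have hab : ∀ b ∈ Bset H v 0, H.Adj a b := fun b hb =>
    adj_of_mem_Aset_zero_of_mem_Bset_two (adj_comp_addLeft_iff hC5 3) htriangle hP2P3
      (by rw [Aset_comp]; exact ha) (by rw [Bset_addLeft]; exact hb)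
  have hdc : H.Adj d c :=
    adj_of_mem_Aset_zero_of_mem_Bset_two (adj_comp_subLeft_iff hC5 4) htriangle hP2P3
      (by rw [Aset_comp]; exact hd) (by rw [Bset_subLeft]; exact hc)
  have hda : ¬ H.Adj d a := fun hda => by
    refine false_of_edge_of_path htriangle hP2P3 (x := v 0) (y := v 1) (z := v 2) hda
      ?_ ?_ (fun h => ?_) ?_ ?_ ?_ ?_ ?_ ?_
    case refine_3 =>
      have h3 : H.Adj (v 2) (v 3) := (hC5 2 3).2 (by decide)
      rw [← h, hC5] at h3
      revert h3
      decide
    all_goals simp [ha.2, hd.2, hC5]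
  have hca : ¬ H.Adj c a :=
    not_adj_of_common_neighbor htriangle (z := v 3) (by simp [hc.2]) (by simp [ha.2])
  have hcb : ∀ b ∈ Bset H v 0, ¬ H.Adj c b := fun b hb =>
    not_adj_of_common_neighbor htriangle (z := v 1) (by simp [hc.2]) (by simp [hb.2])
  have hdb : ∀ b ∈ Bset H v 0, ¬ H.Adj d b := fun b hb =>
    not_adj_of_common_neighbor htriangle (z := v 4) (by simp [hd.2]) ((hb.2 4).2 (by decide))
  intro b hb b' hb'
  by_contra hne
  exact false_of_edge_of_path htriangle hP2P3 hdc (hab b hb).symm (hab b' hb') hne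
    (hdb b hb) hda (hdb b' hb') (hcb b hb) hca (hcb b' hb')

theorem stmt17 {V : Type*} [Fintype V] (H : SimpleGraph V) (v : Fin 5 → V)
    (hinj : Function.Injective v)
    (hC5 : ∀ i j : Fin 5, H.Adj (v i) (v j) ↔ (j = i + 1 ∨ i = j + 1))
    (htriangle : H.CliqueFree 3)
    (hP2P3 : ¬ Nonempty (p2p3 ↪g H))
    : ∀ i : Fin 5, (Bset H v i).Nonempty → (Bset H v (i + 2)).Nonempty →
      ((Aset H v i ∪ Aset H v (i + 2)).Nonempty ∨
        ((Aset H v (i - 2)).Nonempty ∧ (Aset H v (i - 1)).Nonempty)) →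
      (Bset H v i).ncard = 1 ∧ (Bset H v (i + 2)).ncard = 1 := by
  intro i hBi hBi2 hA
  suffices h : (Bset H v i).Subsingleton ∧ (Bset H v (i + 2)).Subsingleton from
    ⟨le_antisymm (Set.ncard_le_one_iff_subsingleton.2 h.1) ((Set.ncard_pos).2 hBi),
      le_antisymm (Set.ncard_le_one_iff_subsingleton.2 h.2) ((Set.ncard_pos).2 hBi2)⟩
  have e0 : i + 0 = i := add_zero i
  have e1 : i + 2 - 0 = i + 2 := sub_zero _
  have e2 : i + 2 - 2 = i := by clear * -; revert i; decide
  have e3 : i + 3 = i - 2 := by clear * -; revert i; decide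
  have e4 : i + 4 = i - 1 := by clear * -; revert i; decide
  have e5 : i + 2 - 3 = i - 1 := by clear * -; revert i; decide
  have e6 : i + 2 - 4 = i - 2 := by clear * -; revert i; decide
  have rotate := adj_comp_addLeft_iff hC5 i
  have reflect := adj_comp_subLeft_iff hC5 (i + 2)
  rcases hA with hA | ⟨hA3, hA4⟩
  · rcases Set.union_nonempty.1 hA with hA | hA
    · have h := subsingleton_of_nonempty_Aset_zero rotate htriangle hP2P3
      simp only [Bset_addLeft, Aset_addLeft, e0] at h
      exact h hBi hBi2 hA
    · have h := subsingleton_of_nonempty_Aset_zero reflect htriangle hP2P3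
      simp only [Bset_subLeft, Aset_subLeft, e1, e2] at h
      exact (h hBi2 hBi hA).symm
  · have h := Bset_zero_subsingleton rotate htriangle hP2P3
    have h' := Bset_zero_subsingleton reflect htriangle hP2P3
    simp only [Bset_addLeft, Aset_addLeft, e0, e3, e4] at h
    simp only [Bset_subLeft, Aset_subLeft, e1, e2, e5, e6] at h'
    exact ⟨h hBi2 hA3 hA4, h' hBi hA4 hA3⟩
end

section
/- If one of the following holds: (1) exactly two of the sets B_1,...,B_5 are nonempty, these are B_i and B_{i+2} for some i ∈ {1,...,5} (indices modulo 5), and h_A ≥ 3; (2) exactly three of the sets B_1,...,B_5 are nonempty, these are B_{i−2}, B_i and B_{i+2} for some i ∈ {1,...,5}, and A_{i−2} ∪ A_i ∪ A_{i+2} ≠ ∅; (3) at least four of the sets B_1,...,B_5 are nonempty and h_A ≥ 1; then |B_j| ≤ 1 for every j ∈ {1,...,5}, the union B_1 ∪ ... ∪ B_5 is an independent set, |S2| ≤ 1, and S2 is complete to B_1 ∪ ... ∪ B_5. -/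
open SimpleGraph

variable {V : Type*}

namespace InducedC5

theorem exists_embedding_of_edge_of_path {V : Type*} {H : SimpleGraph V} {a b c d e : V}
    (hab : H.Adj a b) (hcd : H.Adj c d) (hde : H.Adj d e) (hce : c ≠ e) (nce : ¬ H.Adj c e)
    (nac : ¬ H.Adj a c) (nad : ¬ H.Adj a d) (nae : ¬ H.Adj a e)
    (nbc : ¬ H.Adj b c) (nbd : ¬ H.Adj b d) (nbe : ¬ H.Adj b e) :
    Nonempty (p2p3 ↪g H) := by
  have hadj : ∀ x y : Fin 5, H.Adj (![a, b, c, d, e] x) (![a, b, c, d, e] y) ↔ p2p3.Adj x y := by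
    intro x y
    fin_cases x <;> fin_cases y <;> simp [p2p3, *, H.adj_comm]
  refine ⟨⟨⟨![a, b, c, d, e], ?_⟩, hadj _ _⟩⟩
  intro x y hxy
  have hac : a ≠ c := by rintro rfl; exact nbc hab.symm
  have had : a ≠ d := by rintro rfl; exact nbd hab.symm
  have hae : a ≠ e := by rintro rfl; exact nbe hab.symm
  have hbc : b ≠ c := by rintro rfl; exact nac hab
  have hbd : b ≠ d := by rintro rfl; exact nad hab
  have hbe : b ≠ e := by rintro rfl; exact nae hab
  have := hab.ne
  have := hcd.ne
  have := hde.ne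
  fin_cases x <;> fin_cases y <;> simp at hxy ⊢ <;> grind

/-- `v` is an induced 5-cycle in a graph with neither triangles nor induced `P2 ∪ P3`. -/
structure IsFree {V : Type*} (H : SimpleGraph V) (v : Fin 5 → V) : Prop where
  injective : Function.Injective v
  adj_iff : ∀ i j : Fin 5, H.Adj (v i) (v j) ↔ (j = i + 1 ∨ i = j + 1)
  not_adj : ∀ {a b c : V}, H.Adj c a → H.Adj c b → ¬ H.Adj a b
  not_edge_path : ∀ {a b c d e : V}, H.Adj a b → H.Adj c d → H.Adj d e → c ≠ e →
    ¬ H.Adj a c → ¬ H.Adj a d → ¬ H.Adj a e → ¬ H.Adj b c → ¬ H.Adj b d → ¬ H.Adj b e → False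

theorem isFree {V : Type*} {H : SimpleGraph V} {v : Fin 5 → V}
    (hinj : Function.Injective v)
    (hC5 : ∀ i j : Fin 5, H.Adj (v i) (v j) ↔ (j = i + 1 ∨ i = j + 1))
    (htriangle : H.CliqueFree 3) (hP2P3 : ¬ Nonempty (p2p3 ↪g H)) : IsFree H v := by
  have tri : ∀ {a b c : V}, H.Adj c a → H.Adj c b → ¬ H.Adj a b := by
    classical
    intro a b c hca hcb hab
    exact htriangle {c, a, b} (SimpleGraph.is3Clique_triple_iff.2 ⟨hca, hcb, hab⟩)
  exact ⟨hinj, hC5, tri, fun hab hcd hde hce nac nad nae nbc nbd nbe => hP2P3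
    (exists_embedding_of_edge_of_path hab hcd hde hce (tri hcd.symm hde) nac nad nae nbc nbd nbe)⟩

namespace IsFree

variable {V : Type*} {H : SimpleGraph V} {v : Fin 5 → V} {i j : Fin 5} {a b c s t : V}

/-- Vertices with a common neighbor on the cycle are not adjacent. -/
theorem not_adj_of_common (hf : IsFree H v) (j : Fin 5) (ha : H.Adj a (v j))
    (hb : H.Adj b (v j)) : ¬ H.Adj a b :=
  hf.not_adj ha.symm hb.symm

theorem not_adj_Aset_Bset (hf : IsFree H v) (ha : a ∈ Aset H v i) (hb : b ∈ Bset H v i) :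
    ¬ H.Adj a b := by
  intro hadj
  have h := hf.adj_iff
  obtain ⟨ha0, ha⟩ := ha
  obtain ⟨hb0, hb⟩ := hb
  apply hf.not_edge_path (a := v (i + 2)) (b := v (i + 3)) (c := v i) (d := a) (e := b) <;>
    grind [H.adj_comm, S0]

theorem not_adj_Aset_succ (hf : IsFree H v) (ha : a ∈ Aset H v i) (hb : b ∈ Aset H v j)
    (hij : j = i + 1) :
    ¬ H.Adj a b := by
  intro hadj
  subst hij
  have h := hf.adj_iff
  have hinj := hf.injective
  obtain ⟨ha0, ha⟩ := ha
  obtain ⟨hb0, hb⟩ := hb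
  apply hf.not_edge_path (a := a) (b := b) (c := v (i + 2)) (d := v (i + 3)) (e := v (i + 4)) <;>
    grind [H.adj_comm, S0]

theorem adj_Aset_Bset_add_two (hf : IsFree H v) (ha : a ∈ Aset H v i) (hb : b ∈ Bset H v j)
    (hij : j = i + 2) :
    H.Adj a b := by
  by_contra hadj
  subst hij
  have h := hf.adj_iff
  obtain ⟨ha0, ha⟩ := ha
  obtain ⟨hb0, hb⟩ := hb
  apply hf.not_edge_path (a := a) (b := v i) (c := v (i + 2)) (d := v (i + 3)) (e := b) <;>
    grind [H.adj_comm, S0]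

theorem adj_Aset_Bset_add_three (hf : IsFree H v) (ha : a ∈ Aset H v i) (hb : b ∈ Bset H v j)
    (hij : j = i + 3) :
    H.Adj a b := by
  by_contra hadj
  subst hij
  have h := hf.adj_iff
  obtain ⟨ha0, ha⟩ := ha
  obtain ⟨hb0, hb⟩ := hb
  apply hf.not_edge_path (a := a) (b := v i) (c := v (i + 3)) (d := v (i + 2)) (e := b) <;>
    grind [H.adj_comm, S0]

theorem not_adj_S2set_Aset (hf : IsFree H v) (hs : s ∈ S2set H v) (ha : a ∈ Aset H v i) :
    ¬ H.Adj s a := by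
  intro hadj
  have h := hf.adj_iff
  have hinj := hf.injective
  obtain ⟨hs0, hs, -⟩ := hs
  obtain ⟨ha0, ha⟩ := ha
  apply hf.not_edge_path (a := s) (b := a) (c := v (i + 1)) (d := v (i + 2)) (e := v (i + 3)) <;>
    grind [H.adj_comm, S0]

theorem not_adj_Bset_add_two (hf : IsFree H v) (hb : b ∈ Bset H v i)
    (hc : c ∈ Bset H v j) (hij : j = i + 2) : ¬ H.Adj b c :=
  hf.not_adj_of_common (i + 1) ((hb.2 _).2 (by grind)) ((hc.2 _).2 (by grind))

theorem not_adj_Bset_self (hf : IsFree H v) (hb : b ∈ Bset H v i)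
    (hc : c ∈ Bset H v i) : ¬ H.Adj b c :=
  hf.not_adj_of_common (i + 1) ((hb.2 _).2 (by grind)) ((hc.2 _).2 (by grind))

theorem adj_S2set_Bset_add_two (hf : IsFree H v) (hs : s ∈ S2set H v) (hb : b ∈ Bset H v i)
    (hc : c ∈ Bset H v (i + 2)) (hsb : H.Adj s b) : H.Adj s c := by
  by_contra hadj
  have h := hf.adj_iff
  have hn := hf.not_adj_Bset_add_two hb hc (by grind)
  obtain ⟨hs0, hs, -⟩ := hs
  obtain ⟨hb0, hb⟩ := hb
  obtain ⟨hc0, hc⟩ := hc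
  apply hf.not_edge_path (a := s) (b := b) (c := v (i + 2)) (d := v (i + 3)) (e := c) <;>
    grind [H.adj_comm, S0]

theorem adj_S2set_Bset_add_three (hf : IsFree H v) (hs : s ∈ S2set H v) (hb : b ∈ Bset H v i)
    (hc : c ∈ Bset H v (i + 3)) (hsb : H.Adj s b) : H.Adj s c := by
  by_contra hadj
  have h := hf.adj_iff
  have hn := hf.not_adj_Bset_add_two hc hb (by grind)
  obtain ⟨hs0, hs, -⟩ := hs
  obtain ⟨hb0, hb⟩ := hb
  obtain ⟨hc0, hc⟩ := hc
  apply hf.not_edge_path (a := s) (b := b) (c := v (i + 3)) (d := v (i + 2)) (e := c) <;>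
    grind [H.adj_comm, S0]

theorem S2set_eq_of_adj (hf : IsFree H v) (hs : s ∈ S2set H v) (ht : t ∈ S2set H v)
    (hb : b ∈ Bset H v i) (hsb : H.Adj s b) (htb : H.Adj t b) : s = t := by
  by_contra hst
  have h := hf.adj_iff
  obtain ⟨hb0, hb⟩ := hb
  apply hf.not_edge_path (a := v (i + 2)) (b := v (i + 3)) (c := s) (d := b) (e := t) <;>
    grind [H.adj_comm, S2set]

theorem adj_Bset_add_two_of_adj (hf : IsFree H v) (hb : b ∈ Bset H v i) (hc : c ∈ Bset H v (i + 1))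
    (hs : s ∈ Bset H v (i + 2)) (hbc : H.Adj b c) : H.Adj c s := by
  by_contra hadj
  have h := hf.adj_iff
  have hn := hf.not_adj_Bset_add_two hb hs (by grind)
  obtain ⟨hb0, hb⟩ := hb
  obtain ⟨hc0, hc⟩ := hc
  obtain ⟨hs0, hs⟩ := hs
  apply hf.not_edge_path (a := v (i + 3)) (b := s) (c := v i) (d := c) (e := b) <;>
    grind [H.adj_comm, S0]

theorem adj_Bset_add_four_of_adj (hf : IsFree H v) (hb : b ∈ Bset H v i) (hc : c ∈ Bset H v (i + 1))
    (hs : s ∈ Bset H v (i + 4)) (hbc : H.Adj b c) : H.Adj s b := by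
  by_contra hadj
  have h := hf.adj_iff
  have hn := hf.not_adj_Bset_add_two hs hc (by grind)
  obtain ⟨hb0, hb⟩ := hb
  obtain ⟨hc0, hc⟩ := hc
  obtain ⟨hs0, hs⟩ := hs
  apply hf.not_edge_path (a := v (i + 3)) (b := s) (c := v (i + 1)) (d := b) (e := c) <;>
    grind [H.adj_comm, S0]

theorem not_adj_Bset_succ_of_Aset_add_three (hf : IsFree H v) (hb : b ∈ Bset H v i)
    (hc : c ∈ Bset H v (i + 1)) (ha : a ∈ Aset H v (i + 3)) : ¬ H.Adj b c :=
  hf.not_adj (hf.adj_Aset_Bset_add_two ha hb (by grind))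
    (hf.adj_Aset_Bset_add_three ha hc (by grind))

theorem not_adj_Bset_succ_of_Aset (hf : IsFree H v) (hb : b ∈ Bset H v i)
    (hc : c ∈ Bset H v (i + 1)) (ha : a ∈ Aset H v i) (hs : s ∈ Bset H v (i + 3)) :
    ¬ H.Adj b c := by
  intro hadj
  have h := hf.adj_iff
  have h5 := hf.not_adj_of_common i ((ha.2 _).2 rfl) ((hc.2 _).2 (by grind))
  have h1 := hf.not_adj_Aset_Bset ha hb
  have h2 := hf.adj_Aset_Bset_add_three ha hs (by grind)
  have h3 := hf.not_adj_Bset_add_two hc hs (by grind)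
  have h4 := hf.not_adj_Bset_add_two hs hb (by grind)
  obtain ⟨ha0, ha⟩ := ha
  obtain ⟨hb0, hb⟩ := hb
  obtain ⟨hc0, hc⟩ := hc
  obtain ⟨hs0, hs⟩ := hs
  apply hf.not_edge_path (a := a) (b := s) (c := v (i + 1)) (d := b) (e := c) <;>
    grind [H.adj_comm, S0]

theorem not_adj_Bset_succ_of_Aset_succ (hf : IsFree H v) (hb : b ∈ Bset H v i)
    (hc : c ∈ Bset H v (i + 1)) (ha : a ∈ Aset H v (i + 1)) (hs : s ∈ Bset H v (i + 3)) :
    ¬ H.Adj b c := by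
  intro hadj
  have h := hf.adj_iff
  have h5 := hf.not_adj_of_common (i + 1) ((ha.2 _).2 rfl) ((hb.2 _).2 (by grind))
  have h1 := hf.not_adj_Aset_Bset ha hc
  have h2 := hf.adj_Aset_Bset_add_two ha hs (by grind)
  have h3 := hf.not_adj_Bset_add_two hc hs (by grind)
  have h4 := hf.not_adj_Bset_add_two hs hb (by grind)
  obtain ⟨ha0, ha⟩ := ha
  obtain ⟨hb0, hb⟩ := hb
  obtain ⟨hc0, hc⟩ := hc
  obtain ⟨hs0, hs⟩ := hs
  apply hf.not_edge_path (a := a) (b := s) (c := v i) (d := c) (e := b) <;>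
    grind [H.adj_comm, S0]

theorem Bset_eq_of_edge (hf : IsFree H v) (hb : b ∈ Bset H v i) (hc : c ∈ Bset H v i)
    (hst : H.Adj s t) (hsb : ¬ H.Adj s b) (hsc : ¬ H.Adj s c) (htb : ¬ H.Adj t b)
    (htc : ¬ H.Adj t c) (k : Fin 5) (hk : k = i + 1 ∨ k = i + 4) (hsk : ¬ H.Adj s (v k))
    (htk : ¬ H.Adj t (v k)) : b = c := by
  by_contra hbc
  have h1 := hb.2 k
  have h2 := hc.2 k
  apply hf.not_edge_path (a := s) (b := t) (c := b) (d := v k) (e := c) <;>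
    grind [H.adj_comm]

theorem Bset_eq_of_succ (hf : IsFree H v) (hb : b ∈ Bset H v i) (hc : c ∈ Bset H v i)
    (hs : s ∈ Bset H v (i + 1)) (hsb : ¬ H.Adj s b) (hsc : ¬ H.Adj s c) : b = c := by
  have h := hf.adj_iff
  apply hf.Bset_eq_of_edge hb hc (s := s) (t := v (i + 2)) (k := i + 4) <;>
    grind [H.adj_comm, Bset]

theorem Bset_eq_of_pred (hf : IsFree H v) (hb : b ∈ Bset H v i) (hc : c ∈ Bset H v i)
    (hs : s ∈ Bset H v (i + 4)) (hsb : ¬ H.Adj s b) (hsc : ¬ H.Adj s c) : b = c := by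
  have h := hf.adj_iff
  apply hf.Bset_eq_of_edge hb hc (s := s) (t := v (i + 3)) (k := i + 1) <;>
    grind [H.adj_comm, Bset]

theorem Bset_eq_of_Aset_add_two (hf : IsFree H v) (hb : b ∈ Bset H v i) (hc : c ∈ Bset H v i)
    (ha : a ∈ Aset H v i) (hs : s ∈ Bset H v (i + 2)) : b = c := by
  apply hf.Bset_eq_of_edge hb hc (hf.adj_Aset_Bset_add_two ha hs rfl) (k := i + 4) <;>
    grind [H.adj_comm, Bset, Aset, hf.not_adj_Aset_Bset, hf.not_adj_Bset_add_two]

theorem Bset_eq_of_Aset_add_three (hf : IsFree H v) (hb : b ∈ Bset H v i) (hc : c ∈ Bset H v i)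
    (ha : a ∈ Aset H v i) (hs : s ∈ Bset H v (i + 3)) : b = c := by
  have h1 := hf.not_adj_Bset_add_two hs hb (by grind)
  have h2 := hf.not_adj_Bset_add_two hs hc (by grind)
  apply hf.Bset_eq_of_edge hb hc (hf.adj_Aset_Bset_add_three ha hs rfl) (k := i + 1) <;>
    grind [H.adj_comm, Bset, Aset, hf.not_adj_Aset_Bset]

theorem Bset_eq_of_Aset_Bset_add_two (hf : IsFree H v) (hb : b ∈ Bset H v i) (hc : c ∈ Bset H v i)
    (ha : a ∈ Aset H v (i + 2)) (hs : s ∈ Bset H v (i + 2)) : b = c := by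
  by_contra hbc
  have h := hf.adj_iff
  have h3 := hf.not_adj_Bset_add_two hb hs (by grind)
  have h4 := hf.not_adj_Bset_add_two hc hs (by grind)
  have h1 := hf.adj_Aset_Bset_add_three ha hb (by grind)
  have h2 := hf.adj_Aset_Bset_add_three ha hc (by grind)
  have h5 := hf.not_adj_Aset_Bset ha hs
  obtain ⟨ha0, ha⟩ := ha
  obtain ⟨hb0, hb⟩ := hb
  obtain ⟨hc0, hc⟩ := hc
  obtain ⟨hs0, hs⟩ := hs
  apply hf.not_edge_path (a := v (i + 3)) (b := s) (c := b) (d := a) (e := c) <;>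
    grind [H.adj_comm, S0]

theorem Bset_eq_of_Aset_Bset_add_three (hf : IsFree H v) (hb : b ∈ Bset H v i) (hc : c ∈ Bset H v i)
    (ha : a ∈ Aset H v (i + 3)) (hs : s ∈ Bset H v (i + 3)) : b = c := by
  by_contra hbc
  have h := hf.adj_iff
  have h3 := hf.not_adj_Bset_add_two hs hb (by grind)
  have h4 := hf.not_adj_Bset_add_two hs hc (by grind)
  have h1 := hf.adj_Aset_Bset_add_two ha hb (by grind)
  have h2 := hf.adj_Aset_Bset_add_two ha hc (by grind)
  have h5 := hf.not_adj_Aset_Bset ha hs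
  obtain ⟨ha0, ha⟩ := ha
  obtain ⟨hb0, hb⟩ := hb
  obtain ⟨hc0, hc⟩ := hc
  obtain ⟨hs0, hs⟩ := hs
  apply hf.not_edge_path (a := v (i + 2)) (b := s) (c := b) (d := a) (e := c) <;>
    grind [H.adj_comm, S0]

theorem Bset_eq_of_Aset_one_two (hf : IsFree H v) (hb : b ∈ Bset H v i) (hc : c ∈ Bset H v i)
    (ha : a ∈ Aset H v (i + 2)) (ht : t ∈ Aset H v (i + 1))
    (hs : s ∈ Bset H v (i + 3)) : b = c := by
  by_contra hbc
  have h := hf.adj_iff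
  have h8 := hf.not_adj_of_common (i + 1) ((ht.2 _).2 rfl) ((hb.2 _).2 (by grind))
  have h9 := hf.not_adj_of_common (i + 1) ((ht.2 _).2 rfl) ((hc.2 _).2 (by grind))
  have h10 := hf.not_adj_of_common (i + 2) ((ha.2 _).2 rfl) ((hs.2 _).2 (by grind))
  have h3 := hf.not_adj_Bset_add_two hs hb (by grind)
  have h4 := hf.not_adj_Bset_add_two hs hc (by grind)
  have h1 := hf.adj_Aset_Bset_add_three ha hb (by grind)
  have h2 := hf.adj_Aset_Bset_add_three ha hc (by grind)
  have h6 := hf.adj_Aset_Bset_add_two ht hs (by grind)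
  have h7 := hf.not_adj_Aset_succ ht ha (by grind)
  obtain ⟨ha0, ha⟩ := ha
  obtain ⟨hb0, hb⟩ := hb
  obtain ⟨hc0, hc⟩ := hc
  obtain ⟨hs0, hs⟩ := hs
  obtain ⟨ht0, ht⟩ := ht
  apply hf.not_edge_path (a := t) (b := s) (c := b) (d := a) (e := c) <;>
    grind [H.adj_comm, S0]

theorem Bset_eq_of_Aset_three_four (hf : IsFree H v) (hb : b ∈ Bset H v i) (hc : c ∈ Bset H v i)
    (ha : a ∈ Aset H v (i + 3)) (ht : t ∈ Aset H v (i + 4))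
    (hs : s ∈ Bset H v (i + 2)) : b = c := by
  by_contra hbc
  have h := hf.adj_iff
  have h8 := hf.not_adj_of_common (i + 4) ((ht.2 _).2 rfl) ((hb.2 _).2 (by grind))
  have h9 := hf.not_adj_of_common (i + 4) ((ht.2 _).2 rfl) ((hc.2 _).2 (by grind))
  have h10 := hf.not_adj_of_common (i + 3) ((ha.2 _).2 rfl) ((hs.2 _).2 (by grind))
  have h3 := hf.not_adj_Bset_add_two hb hs (by grind)
  have h4 := hf.not_adj_Bset_add_two hc hs (by grind)
  have h1 := hf.adj_Aset_Bset_add_two ha hb (by grind)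
  have h2 := hf.adj_Aset_Bset_add_two ha hc (by grind)
  have h6 := hf.adj_Aset_Bset_add_three ht hs (by grind)
  have h7 := hf.not_adj_Aset_succ ha ht (by grind)
  obtain ⟨ha0, ha⟩ := ha
  obtain ⟨hb0, hb⟩ := hb
  obtain ⟨hc0, hc⟩ := hc
  obtain ⟨hs0, hs⟩ := hs
  obtain ⟨ht0, ht⟩ := ht
  apply hf.not_edge_path (a := t) (b := s) (c := b) (d := a) (e := c) <;>
    grind [H.adj_comm, S0]

theorem exists_adj_Bset (hf : IsFree H v) (hs : s ∈ S2set H v) :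
    ∃ k, ∃ b ∈ Bset H v k, H.Adj s b := by
  have hs' := hs
  obtain ⟨hs0, hsv, y, hsy, j, hyj⟩ := hs
  have hy0 : y ∉ S0 v := by rintro ⟨k, rfl⟩; exact hsv k hsy
  have hcyc : ∀ k : Fin 5, k = j ∨ k = j + 1 ∨ k = j + 2 ∨ k = j + 3 ∨ k = j + 4 := by
    clear * -
    decide +revert
  have hv : ∀ k, H.Adj (v k) (v (k + 1)) := fun k => (hf.adj_iff _ _).2 (Or.inl rfl)
  have hcons : ∀ k, H.Adj y (v k) → ¬ H.Adj y (v (k + 1)) := fun k h1 h2 => hf.not_adj h1 h2 (hv k)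
  have h0 := hcons j hyj
  have h4 : ¬ H.Adj y (v (j + 4)) := fun h =>
    hcons _ h (by rwa [show j + 4 + 1 = j by grind])
  by_cases h2 : H.Adj y (v (j + 2))
  · have h3 : ¬ H.Adj y (v (j + 3)) := fun h =>
      hcons _ h2 (by rwa [show j + 2 + 1 = j + 3 by grind])
    exact ⟨j + 1, y, ⟨hy0, fun k => by rcases hcyc k with rfl | rfl | rfl | rfl | rfl <;> grind⟩,
      hsy⟩
  by_cases h3 : H.Adj y (v (j + 3))
  · exact ⟨j + 4, y, ⟨hy0, fun k => by rcases hcyc k with rfl | rfl | rfl | rfl | rfl <;> grind⟩,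
      hsy⟩
  exact absurd hsy (hf.not_adj_S2set_Aset (i := j) hs'
    ⟨hy0, fun k => by rcases hcyc k with rfl | rfl | rfl | rfl | rfl <;> grind⟩)

end IsFree

/-- The possible shapes of the set of indices `j` with `B_j` nonempty. -/
abbrev Shape (b : Finset (Fin 5)) : Prop :=
  (∃ i, b.card = 2 ∧ i ∈ b ∧ i + 2 ∈ b) ∨
    (∃ i, b.card = 3 ∧ i - 2 ∈ b ∧ i ∈ b ∧ i + 2 ∈ b) ∨ 4 ≤ b.card

/-- The hypothesis on the sets of indices `j` with `A_j`, respectively `B_j`, nonempty. -/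
abbrev IndexCondition (a b : Finset (Fin 5)) : Prop :=
  (∃ i, b.card = 2 ∧ i ∈ b ∧ i + 2 ∈ b ∧ 3 ≤ a.card) ∨
    (∃ i, b.card = 3 ∧ i - 2 ∈ b ∧ i ∈ b ∧ i + 2 ∈ b ∧ (i - 2 ∈ a ∨ i ∈ a ∨ i + 2 ∈ a)) ∨
    (4 ≤ b.card ∧ 1 ≤ a.card)

theorem IndexCondition.shape {a b : Finset (Fin 5)} (h : IndexCondition a b) : Shape b := by
  rcases h with ⟨i, h1, h2, h3, -⟩ | ⟨i, h1, h2, h3, h4, -⟩ | ⟨h, -⟩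
  exacts [Or.inl ⟨i, h1, h2, h3⟩, Or.inr (Or.inl ⟨i, h1, h2, h3, h4⟩), Or.inr (Or.inr h)]

set_option synthInstance.maxSize 1000 in
set_option maxRecDepth 100000 in
theorem Shape.mem_of_closed : ∀ b, Shape b → ∀ p ⊆ b, p.Nonempty →
    (∀ i ∈ p, (i + 2 ∈ b → i + 2 ∈ p) ∧ (i + 3 ∈ b → i + 3 ∈ p)) →
    ∀ j ∈ b, j + 2 ∈ p ∨ j + 3 ∈ p := by
  decide

set_option synthInstance.maxSize 1000 in
set_option maxRecDepth 100000 in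
theorem Shape.eq_empty_of_closed : ∀ b, Shape b → ∀ k : Fin 5,
    (b.card = 3 → ∃ i, i - 2 ∈ b ∧ i ∈ b ∧ i + 2 ∈ b ∧ (k = i - 2 ∨ k = i ∨ k = i + 2)) →
    ∀ p ⊆ b, (∀ i ∈ p, i + 1 ∈ b ∧ (i + 2 ∈ b → i + 1 ∈ p) ∧ (i + 4 ∈ b → i + 4 ∈ p) ∧
      k ≠ i + 3 ∧ (i + 3 ∈ b → k ≠ i ∧ k ≠ i + 1)) → p = ∅ := by
  decide

set_option synthInstance.maxSize 1000 in
set_option maxRecDepth 100000 in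
theorem IndexCondition.cover : ∀ b a, IndexCondition a b → ∀ j ∈ b,
    j + 1 ∈ b ∨ j + 4 ∈ b ∨ (j ∈ a ∧ j + 2 ∈ b) ∨ (j ∈ a ∧ j + 3 ∈ b) ∨
      (j + 2 ∈ a ∧ j + 2 ∈ b) ∨ (j + 3 ∈ a ∧ j + 3 ∈ b) ∨
      (j + 2 ∈ a ∧ j + 1 ∈ a ∧ j + 3 ∈ b) ∨ (j + 3 ∈ a ∧ j + 4 ∈ a ∧ j + 2 ∈ b) := by
  decide

open Classical in
/-- The indices `j` such that `S j` is nonempty. -/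
noncomputable def nonemptyIndices {V : Type*} (S : Fin 5 → Set V) : Finset (Fin 5) :=
  Finset.univ.filter fun j => (S j).Nonempty

theorem mem_nonemptyIndices {V : Type*} {S : Fin 5 → Set V} {j : Fin 5} :
    j ∈ nonemptyIndices S ↔ (S j).Nonempty := by
  simp [nonemptyIndices]

theorem ncard_eq_card_nonemptyIndices {V : Type*} (S : Fin 5 → Set V) :
    {j : Fin 5 | (S j).Nonempty}.ncard = (nonemptyIndices S).card := by
  rw [← Set.ncard_coe_finset]
  congr 1
  ext j
  simp [mem_nonemptyIndices]

namespace IsFree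

variable {V : Type*} {H : SimpleGraph V} {v : Fin 5 → V} {j : Fin 5} {b c s : V}

theorem adj_S2set_Bset (hf : IsFree H v) (hshape : Shape (nonemptyIndices (Bset H v)))
    (hs : s ∈ S2set H v) (hb : b ∈ Bset H v j) : H.Adj s b := by
  obtain ⟨k, c, hc, hsc⟩ := hf.exists_adj_Bset hs
  have hp := hshape.mem_of_closed _ (nonemptyIndices fun j => {b ∈ Bset H v j | H.Adj s b})
    (fun i hi => mem_nonemptyIndices.2 ((mem_nonemptyIndices.1 hi).mono fun x hx => hx.1))
    ⟨k, mem_nonemptyIndices.2 ⟨c, hc, hsc⟩⟩ ?_ j (mem_nonemptyIndices.2 ⟨b, hb⟩)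
  · simp only [mem_nonemptyIndices] at hp
    rcases hp with ⟨x, hx, hsx⟩ | ⟨x, hx, hsx⟩
    · exact hf.adj_S2set_Bset_add_three hs hx (by rwa [show j + 2 + 3 = j by grind]) hsx
    · exact hf.adj_S2set_Bset_add_two hs hx (by rwa [show j + 3 + 2 = j by grind]) hsx
  · simp only [mem_nonemptyIndices]
    rintro i ⟨x, hx, hsx⟩
    exact ⟨fun ⟨y, hy⟩ => ⟨y, hy, hf.adj_S2set_Bset_add_two hs hx hy hsx⟩,
      fun ⟨y, hy⟩ => ⟨y, hy, hf.adj_S2set_Bset_add_three hs hx hy hsx⟩⟩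

theorem not_adj_Bset_succ (hf : IsFree H v)
    (hcond : IndexCondition (nonemptyIndices (Aset H v)) (nonemptyIndices (Bset H v)))
    (hb : b ∈ Bset H v j) (hc : c ∈ Bset H v (j + 1)) : ¬ H.Adj b c := by
  obtain ⟨k, hk, hk3⟩ : ∃ k ∈ nonemptyIndices (Aset H v), (nonemptyIndices (Bset H v)).card = 3 →
      ∃ i, i - 2 ∈ nonemptyIndices (Bset H v) ∧ i ∈ nonemptyIndices (Bset H v) ∧
        i + 2 ∈ nonemptyIndices (Bset H v) ∧
        (k = i - 2 ∨ k = i ∨ k = i + 2) := by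
    rcases hcond with ⟨i, h2, -, -, ha⟩ | ⟨i, -, h1, h2, h3, ha⟩ | ⟨h4, ha⟩
    · obtain ⟨k, hk⟩ := Finset.card_pos.1 (by omega : 0 < (nonemptyIndices (Aset H v)).card)
      exact ⟨k, hk, by omega⟩
    · rcases ha with ha | ha | ha
      exacts [⟨_, ha, fun _ => ⟨i, h1, h2, h3, by simp⟩⟩,
        ⟨_, ha, fun _ => ⟨i, h1, h2, h3, by simp⟩⟩,
        ⟨_, ha, fun _ => ⟨i, h1, h2, h3, by simp⟩⟩]
    · obtain ⟨k, hk⟩ := Finset.card_pos.1 ha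
      exact ⟨k, hk, by omega⟩
  obtain ⟨a, ha⟩ := mem_nonemptyIndices.1 hk
  intro hbc
  have hp := Shape.eq_empty_of_closed _ hcond.shape k hk3
    (nonemptyIndices fun i => {x ∈ Bset H v i | ∃ y ∈ Bset H v (i + 1), H.Adj x y})
    (fun i hi => mem_nonemptyIndices.2 ((mem_nonemptyIndices.1 hi).mono fun x hx => hx.1)) ?_
  · exact Finset.notMem_empty j (hp ▸ mem_nonemptyIndices.2 ⟨b, hb, c, hc, hbc⟩)
  · simp only [mem_nonemptyIndices]
    rintro i ⟨x, hx, y, hy, hxy⟩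
    refine ⟨⟨y, hy⟩, ?_, ?_, ?_, ?_⟩
    · rintro ⟨z, hz⟩
      exact ⟨y, hy, z, by rwa [show i + 1 + 1 = i + 2 by grind],
        hf.adj_Bset_add_two_of_adj hx hy hz hxy⟩
    · rintro ⟨z, hz⟩
      exact ⟨z, hz, x, by rwa [show i + 4 + 1 = i by grind],
        hf.adj_Bset_add_four_of_adj hx hy hz hxy⟩
    · rintro rfl
      exact hf.not_adj_Bset_succ_of_Aset_add_three hx hy ha hxy
    · rintro ⟨z, hz⟩
      constructor <;> rintro rfl
      exacts [hf.not_adj_Bset_succ_of_Aset hx hy ha hz hxy,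
        hf.not_adj_Bset_succ_of_Aset_succ hx hy ha hz hxy]

theorem not_adj_Bset (hf : IsFree H v)
    (hcond : IndexCondition (nonemptyIndices (Aset H v)) (nonemptyIndices (Bset H v))) {i : Fin 5}
    (hb : b ∈ Bset H v i) (hc : c ∈ Bset H v j) : ¬ H.Adj b c := by
  have hij : ∀ i j : Fin 5, j = i ∨ j = i + 1 ∨ j = i + 2 ∨ i = j + 2 ∨ i = j + 1 := by decide
  rcases hij i j with rfl | rfl | h | h | rfl
  · exact hf.not_adj_Bset_self hb hc
  · exact hf.not_adj_Bset_succ hcond hb hc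
  · exact hf.not_adj_Bset_add_two hb hc h
  · exact fun hbc => hf.not_adj_Bset_add_two hc hb h hbc.symm
  · exact fun hbc => hf.not_adj_Bset_succ hcond hc hb hbc.symm

theorem Bset_subsingleton (hf : IsFree H v)
    (hcond : IndexCondition (nonemptyIndices (Aset H v)) (nonemptyIndices (Bset H v))) (j : Fin 5) :
    (Bset H v j).Subsingleton := by
  intro b hb c hc
  have hcov := hcond.cover _ _ j (mem_nonemptyIndices.2 ⟨b, hb⟩)
  simp only [mem_nonemptyIndices] at hcov
  rcases hcov with ⟨s, hs⟩ | ⟨s, hs⟩ | ⟨⟨a, ha⟩, s, hs⟩ | ⟨⟨a, ha⟩, s, hs⟩ | ⟨⟨a, ha⟩, s, hs⟩ |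
    ⟨⟨a, ha⟩, s, hs⟩ | ⟨⟨a, ha⟩, ⟨t, ht⟩, s, hs⟩ | ⟨⟨a, ha⟩, ⟨t, ht⟩, s, hs⟩
  · exact hf.Bset_eq_of_succ hb hc hs (hf.not_adj_Bset hcond hs hb) (hf.not_adj_Bset hcond hs hc)
  · exact hf.Bset_eq_of_pred hb hc hs (hf.not_adj_Bset hcond hs hb) (hf.not_adj_Bset hcond hs hc)
  · exact hf.Bset_eq_of_Aset_add_two hb hc ha hs
  · exact hf.Bset_eq_of_Aset_add_three hb hc ha hs
  · exact hf.Bset_eq_of_Aset_Bset_add_two hb hc ha hs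
  · exact hf.Bset_eq_of_Aset_Bset_add_three hb hc ha hs
  · exact hf.Bset_eq_of_Aset_one_two hb hc ha ht hs
  · exact hf.Bset_eq_of_Aset_three_four hb hc ha ht hs

theorem S2set_subsingleton (hf : IsFree H v) (hshape : Shape (nonemptyIndices (Bset H v))) :
    (S2set H v).Subsingleton := by
  intro s hs t ht
  obtain ⟨k, b, hb, hsb⟩ := hf.exists_adj_Bset hs
  exact hf.S2set_eq_of_adj hs ht hb hsb (hf.adj_S2set_Bset hshape ht hb)

end IsFree

end InducedC5

open InducedC5 in
theorem stmt18 {V : Type*} [Fintype V] (H : SimpleGraph V) (v : Fin 5 → V)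
    (hinj : Function.Injective v)
    (hC5 : ∀ i j : Fin 5, H.Adj (v i) (v j) ↔ (j = i + 1 ∨ i = j + 1))
    (htriangle : H.CliqueFree 3)
    (hP2P3 : ¬ Nonempty (p2p3 ↪g H))
    (hcase : (∃ i : Fin 5, hB H v = 2 ∧ (Bset H v i).Nonempty ∧ (Bset H v (i + 2)).Nonempty ∧
        3 ≤ hA H v) ∨
      (∃ i : Fin 5, hB H v = 3 ∧ (Bset H v (i - 2)).Nonempty ∧ (Bset H v i).Nonempty ∧
        (Bset H v (i + 2)).Nonempty ∧
        (Aset H v (i - 2) ∪ Aset H v i ∪ Aset H v (i + 2)).Nonempty) ∨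
      (4 ≤ hB H v ∧ 1 ≤ hA H v))
    : (∀ j : Fin 5, (Bset H v j).ncard ≤ 1) ∧
      (∀ x ∈ ⋃ j : Fin 5, Bset H v j, ∀ y ∈ ⋃ j : Fin 5, Bset H v j, ¬ H.Adj x y) ∧
      (S2set H v).ncard ≤ 1 ∧
      Complete H (S2set H v) (⋃ j : Fin 5, Bset H v j) := by
  have hf := isFree hinj hC5 htriangle hP2P3
  have hcond : IndexCondition (nonemptyIndices (Aset H v)) (nonemptyIndices (Bset H v)) := by
    simpa only [IndexCondition, hA, hB, ncard_eq_card_nonemptyIndices, mem_nonemptyIndices,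
      Set.union_nonempty, or_assoc] using hcase
  have hunion : ∀ x ∈ ⋃ j : Fin 5, Bset H v j, ∃ j, x ∈ Bset H v j := fun x => Set.mem_iUnion.1
  refine ⟨fun j => ?_, fun x hx y hy => ?_, ?_, fun s hs y hy => ?_⟩
  · exact Set.ncard_le_one_iff_subsingleton.2 (hf.Bset_subsingleton hcond j)
  · obtain ⟨i, hx⟩ := hunion x hx
    obtain ⟨j, hy⟩ := hunion y hy
    exact hf.not_adj_Bset hcond hx hy
  · exact Set.ncard_le_one_iff_subsingleton.2 (hf.S2set_subsingleton hcond.shape)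
  · obtain ⟨j, hy⟩ := hunion y hy
    exact hf.adj_S2set_Bset hcond.shape hs hy
end
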